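/- arXiv:2003.09716 — 4 statements merged into one kernel-verified Lean document; each statement's English description precedes it below -/
import Mathlib

section
/- A code $c$ has convexity deficit exactly $1$ if and only if $c$ contains at least one entry equal to $1$ and contains no two cyclically consecutive entries forming $11$, $12$, or $21$; equivalently, $c$ contains a $1$ and every pair of cyclically consecutive entries $a, b$ of $c$ satisfies $a + b \ge 4$. (Equivalently: a benzenoid is quasi-convex if and only if its boundary-edges code contains at least one $1$ but no sub-sequence $11$, $12$, or $21$.) -/
/-- A code is a string over the alphabet `{1,2,3,4,5}`. -/
def IsCode (c : List ℕ) : Prop := ∀ x ∈ c, 1 ≤ x ∧ x ≤ 5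

/-- The cyclic window of length `m` in a code `c` starting at position `i`:
the string of `m` cyclically consecutive entries of `c` beginning at index `i`. -/
def cwin (c : List ℕ) (i m : ℕ) : List ℕ := (c.rotate i).take m

/-- A code `c` is `k`-convex if every cyclic window of length `k + 1`
(such windows exist when `k + 1 ≤ len c`) has sum at least `2 * (k + 1)`,
i.e. average value at least `2`. -/
def KConvex (c : List ℕ) (k : ℕ) : Prop :=
  ∀ i < c.length, k + 1 ≤ c.length → 2 * (k + 1) ≤ (cwin c i (k + 1)).sum

/-- The convexity deficit of a code: the minimum `k ≥ 0` such that `c` is `k`-convex. -/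
noncomputable def cd (c : List ℕ) : ℕ := sInf {k | KConvex c k}

theorem sum_cwin_one {l : List ℕ} {i : ℕ} (hi : i < l.length) : (cwin l i 1).sum = l[i] := by
  simp [cwin, List.take_one, List.head?_rotate hi, List.getElem?_eq_getElem hi]

theorem kConvex_zero_iff (l : List ℕ) (hcode : IsCode l) (hlen : 1 ≤ l.length) :
    KConvex l 0 ↔ 1 ∉ l := by
  constructor
  · intro h hmem
    obtain ⟨i, hi, hli⟩ := List.mem_iff_getElem.mp hmem
    have := h i hi hlen
    rw [sum_cwin_one hi] at this
    omega
  · intro h i hi _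
    rw [sum_cwin_one hi]
    have hmem := List.getElem_mem hi
    have := (hcode _ hmem).1
    have : l[i] ≠ 1 := fun he => h (he ▸ hmem)
    omega

/-- The deficit is `1` exactly when the code is `1`-convex but not `0`-convex. -/
theorem cd_eq_one_iff_kConvex (c : List ℕ) :
    cd c = 1 ↔ ¬ KConvex c 0 ∧ KConvex c 1 := by
  unfold cd
  constructor
  · intro h
    have hne : {k | KConvex c k}.Nonempty := Nat.nonempty_of_pos_sInf (by omega)
    refine ⟨fun h0 => ?_, ?_⟩
    · have := Nat.sInf_le (s := {k | KConvex c k}) h0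
      omega
    · have := Nat.sInf_mem hne
      rwa [h] at this
  · rintro ⟨h0, h1⟩
    have hle := Nat.sInf_le (s := {k | KConvex c k}) h1
    have hmem : KConvex c (sInf {k | KConvex c k}) := Nat.sInf_mem (s := {k | KConvex c k}) ⟨1, h1⟩
    have : sInf {k | KConvex c k} ≠ 0 := fun he => h0 (he ▸ hmem)
    omega

/-- A code has convexity deficit exactly `1` if and only if it contains at
least one entry equal to `1` and every pair of cyclically consecutive entries
has sum at least `4` (equivalently, no cyclic sub-sequence `11`, `12`, or `21`).
Equivalently: a benzenoid is quasi-convex iff its boundary-edges code contains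
a `1` but no sub-sequence `11`, `12` or `21`. -/
theorem cd_eq_one_iff (c : List ℕ) (hcode : IsCode c) (hlen : 2 ≤ c.length) :
    cd c = 1 ↔ (1 ∈ c ∧ ∀ i < c.length, 4 ≤ (cwin c i 2).sum) := by
  rw [cd_eq_one_iff_kConvex, kConvex_zero_iff c hcode (by omega), not_not]
  exact and_congr_right fun _ => forall₂_congr fun _ _ => ⟨fun h => h hlen, fun h _ => h⟩
end

section
/- For every $h \ge 2$, the helicene code $5\,1^{h-2}\,5\,3^{h-2}$ (the symbol $5$, followed by $h-2$ copies of $1$, the symbol $5$, and $h-2$ copies of $3$) has convexity deficit equal to $\max\{2h-7,\ h-2\}$. -/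
/-- The helicene code with `n = h - 2` copies of `1` and of `3`. -/
abbrev heliceneCode (n : ℕ) : List ℕ :=
  5 :: List.replicate n 1 ++ 5 :: List.replicate n 3

lemma length_heliceneCode (n : ℕ) : (heliceneCode n).length = 2 * n + 2 := by
  simp [heliceneCode]
  omega

lemma sum_heliceneCode (n : ℕ) : (heliceneCode n).sum = 4 * n + 10 := by
  simp [heliceneCode]
  omega

lemma getElem_heliceneCode (n j : ℕ) (hj : j < (heliceneCode n).length) :
    (heliceneCode n)[j] =
      if j = 0 then 5 else if j ≤ n then 1 else if j = n + 1 then 5 else 3 := by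
  rcases j with _ | j
  · simp [heliceneCode]
  · simp only [heliceneCode, List.cons_append, List.getElem_cons_succ, List.getElem_append,
      List.length_replicate, List.getElem_replicate, List.getElem_cons]
    rw [length_heliceneCode] at hj
    split_ifs <;> first | rfl | contradiction | omega

lemma heliceneCode_rotate_one (n : ℕ) :
    (heliceneCode n).rotate 1 = List.replicate n 1 ++ 5 :: (List.replicate n 3 ++ [5]) := by
  simp [heliceneCode]

/-- Of any four cyclically consecutive entries of a helicene code with `n ≥ 3`, at most one is `5`
and the others are at most `3`. -/
lemma sum_drop_rotate_heliceneCode_le {n i : ℕ} (hn : 3 ≤ n) (hi : i < 2 * n + 2) :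
    (((heliceneCode n).rotate i).drop (2 * n - 2)).sum ≤ 14 := by
  have hlen : ((heliceneCode n).rotate i).length = 2 * n + 2 := by
    rw [List.length_rotate, length_heliceneCode]
  rw [List.drop_eq_getElem_cons (by omega), List.drop_eq_getElem_cons (by omega),
    List.drop_eq_getElem_cons (by omega), List.drop_eq_getElem_cons (by omega),
    List.drop_eq_nil_of_le (by omega)]
  simp only [List.getElem_rotate, getElem_heliceneCode, length_heliceneCode, List.sum_cons,
    List.sum_nil]
  have hmod (j : ℕ) (hj : j < 2 * n + 2) :
      j + i < 2 * n + 2 ∧ (j + i) % (2 * n + 2) = j + i ∨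
        2 * n + 2 ≤ j + i ∧ (j + i) % (2 * n + 2) + (2 * n + 2) = j + i := by
    rcases Nat.lt_or_ge (j + i) (2 * n + 2) with h | h
    · exact Or.inl ⟨h, Nat.mod_eq_of_lt h⟩
    · rw [Nat.mod_eq_sub_mod h, Nat.mod_eq_of_lt (by omega)]
      omega
  have h₀ := hmod (2 * n - 2) (by omega)
  have h₁ := hmod (2 * n - 2 + 1) (by omega)
  have h₂ := hmod (2 * n - 2 + 1 + 1) (by omega)
  have h₃ := hmod (2 * n - 2 + 1 + 1 + 1) (by omega)
  clear hmod hlen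
  generalize (2 * n - 2 + i) % (2 * n + 2) = a₀ at *
  generalize (2 * n - 2 + 1 + i) % (2 * n + 2) = a₁ at *
  generalize (2 * n - 2 + 1 + 1 + i) % (2 * n + 2) = a₂ at *
  generalize (2 * n - 2 + 1 + 1 + 1 + i) % (2 * n + 2) = a₃ at *
  split_ifs <;> omega

lemma kConvex_heliceneCode (n : ℕ) : KConvex (heliceneCode n) (max (2 * n - 3) n) := by
  intro i hi hk
  rcases Nat.lt_or_ge n 3 with hn | hn
  · rw [length_heliceneCode] at hi
    interval_cases n <;> interval_cases i <;> decide
  · rw [length_heliceneCode] at hi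
    have hmax : max (2 * n - 3) n + 1 = 2 * n - 2 := by omega
    have hdrop := sum_drop_rotate_heliceneCode_le hn hi
    have htotal := List.sum_take_add_sum_drop ((heliceneCode n).rotate i) (2 * n - 2)
    rw [(List.rotate_perm (heliceneCode n) i).sum_eq, sum_heliceneCode] at htotal
    rw [hmax, cwin]
    omega

lemma not_kConvex_heliceneCode {n k : ℕ} (hk : k < max (2 * n - 3) n) :
    ¬ KConvex (heliceneCode n) k := by
  intro hconv
  have hwin := hconv 1 (by rw [length_heliceneCode]; omega) (by rw [length_heliceneCode]; omega)
  rw [cwin, heliceneCode_rotate_one, List.take_append] at hwin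
  rcases Nat.lt_or_ge k n with hkn | hkn
  · simp [show k + 1 - n = 0 by omega, show min (k + 1) n = k + 1 by omega] at hwin
  · rw [List.length_replicate, show k + 1 - n = (k - n) + 1 by omega, List.take_succ_cons,
      List.take_append_of_le_length (by rw [List.length_replicate]; omega)] at hwin
    simp [show min (k + 1) n = n by omega, show min (k - n) n = k - n by omega] at hwin
    omega

/-- For every `h ≥ 2`, the helicene code `5 1^(h-2) 5 3^(h-2)` has
convexity deficit equal to `max {2h - 7, h - 2}`. -/
theorem cd_helicene (h : ℕ) (hh : 2 ≤ h) :
    cd (5 :: List.replicate (h - 2) 1 ++ 5 :: List.replicate (h - 2) 3)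
      = max (2 * h - 7) (h - 2) := by
  rw [show max (2 * h - 7) (h - 2) = max (2 * (h - 2) - 3) (h - 2) by omega]
  refine le_antisymm (Nat.sInf_le (kConvex_heliceneCode (h - 2))) ?_
  refine le_csInf ⟨_, kConvex_heliceneCode (h - 2)⟩ fun k hk => ?_
  exact not_lt.mp fun hlt => not_kConvex_heliceneCode hlt hk
end

section
/- For every $h \ge 2$ and every code of the form $5\,s_1 s_2 \ldots s_{h-2}\,5\,\bar{s}_1 \bar{s}_2 \ldots \bar{s}_{h-2}$, where each $s_i \in \{1,2,3\}$ and $\bar{s}_i = 4 - s_i$ for all $1 \le i \le h-2$, the convexity deficit of the code is at most $\max\{2h-7,\ h-2\}$. Hence the helicene code $5\,1^{h-2}\,5\,3^{h-2}$ attains the maximal convexity deficit among all such codes. -/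
/-- Every entry of `5 s 5 s̄` is at most `3`, apart from the two entries `5`. -/
lemma getElem_unbranched_le (s : List ℕ) (hs : ∀ x ∈ s, 1 ≤ x ∧ x ≤ 3) (j : ℕ)
    (hj : j < (5 :: s ++ 5 :: s.map (fun x => 4 - x)).length) :
    (5 :: s ++ 5 :: s.map (fun x => 4 - x))[j] ≤ 5 ∧
      (j ≠ 0 → j ≠ s.length + 1 →
        (5 :: s ++ 5 :: s.map (fun x => 4 - x))[j] ≤ 3) := by
  simp only [List.length_append, List.length_cons, List.length_map] at hj
  rcases j with _ | j
  · simp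
  · simp only [List.cons_append, List.getElem_cons_succ]
    rcases lt_trichotomy j s.length with h | h | h
    · rw [List.getElem_append_left h]
      have := hs _ (List.getElem_mem h)
      omega
    · subst h
      simp
    · obtain ⟨d, rfl⟩ := Nat.exists_eq_add_of_lt h
      have hd : d < s.length := by omega
      have := hs _ (List.getElem_mem hd)
      simp only [List.getElem_append_right (show s.length ≤ s.length + d + 1 by omega),
        show s.length + d + 1 - s.length = d + 1 by omega, List.getElem_cons_succ,
        List.getElem_map]
      omega

lemma mod_eq_ite_of_lt_two_mul {x L : ℕ} (h : x < 2 * L) :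
    x % L = if x < L then x else x - L := by
  split_ifs with hx
  · exact Nat.mod_eq_of_lt hx
  · rw [Nat.mod_eq_sub_mod (by omega), Nat.mod_eq_of_lt (by omega)]

lemma sum_unbranched (s : List ℕ) (hs : ∀ x ∈ s, 1 ≤ x ∧ x ≤ 3) :
    (5 :: s ++ 5 :: s.map (fun x => 4 - x)).sum = 10 + 4 * s.length := by
  have key : s.sum + (s.map (fun x => 4 - x)).sum = 4 * s.length := by
    induction s with
    | nil => simp
    | cons a t ih =>
      have := ih fun x hx => hs x (List.mem_cons_of_mem _ hx)
      have := hs a List.mem_cons_self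
      simp only [List.sum_cons, List.map_cons, List.length_cons]
      omega
  simp only [List.sum_append, List.sum_cons]
  omega

/-- A cyclic window of length `4` contains at most one `5` once `s` has at least three entries,
so its complement has average at least `2`. -/
lemma kConvex_unbranched_of_three_le (s : List ℕ) (hs : ∀ x ∈ s, 1 ≤ x ∧ x ≤ 3)
    (hn : 3 ≤ s.length) :
    KConvex (5 :: s ++ 5 :: s.map (fun x => 4 - x)) (2 * s.length - 3) := by
  intro i hi _
  have hsum := sum_unbranched s hs
  have hent := getElem_unbranched_le s hs
  have hlen : (5 :: s ++ 5 :: s.map (fun x => 4 - x)).length = 2 * s.length + 2 := by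
    simp; omega
  generalize 5 :: s ++ 5 :: s.map (fun x => 4 - x) = c at *
  have htot : ((c.rotate i).take (2 * s.length - 3 + 1)).sum
      + ((c.rotate i).drop (2 * s.length - 3 + 1)).sum = c.sum := by
    rw [← List.sum_append, List.take_append_drop]
    exact (List.rotate_perm c i).sum_eq
  have hdrop : ((c.rotate i).drop (2 * s.length - 3 + 1)).sum ≤ 14 := by
    have hl : ((c.rotate i).drop (2 * s.length - 3 + 1)).length = 4 := by
      simp; omega
    have hget : ∀ t (ht : t < ((c.rotate i).drop (2 * s.length - 3 + 1)).length),
        ∃ j, j = (2 * s.length - 3 + 1 + t + i) % c.length ∧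
          ((c.rotate i).drop (2 * s.length - 3 + 1))[t] ≤ 5 ∧
          (j ≠ 0 → j ≠ s.length + 1 →
            ((c.rotate i).drop (2 * s.length - 3 + 1))[t] ≤ 3) := by
      intro t ht
      refine ⟨_, rfl, ?_⟩
      simp only [List.getElem_drop, List.getElem_rotate]
      exact hent _ _
    generalize (c.rotate i).drop (2 * s.length - 3 + 1) = l at *
    obtain ⟨a, b, d, e, rfl⟩ : ∃ a b d e, l = [a, b, d, e] := List.length_eq_four.mp hl
    obtain ⟨j0, e0, h0⟩ := hget 0 (by simp)
    obtain ⟨j1, e1, h1⟩ := hget 1 (by simp)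
    obtain ⟨j2, e2, h2⟩ := hget 2 (by simp)
    obtain ⟨j3, e3, h3⟩ := hget 3 (by simp)
    rw [mod_eq_ite_of_lt_two_mul (by omega)] at e0 e1 e2 e3
    simp only [List.getElem_cons_succ, List.getElem_cons_zero] at h0 h1 h2 h3
    simp only [List.sum_cons, List.sum_nil]
    split_ifs at e0 e1 e2 e3 <;> omega
  unfold cwin
  omega

lemma kConvex_unbranched_of_le_two (s : List ℕ) (hs : ∀ x ∈ s, 1 ≤ x ∧ x ≤ 3)
    (hn : s.length ≤ 2) :
    KConvex (5 :: s ++ 5 :: s.map (fun x => 4 - x)) s.length := by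
  intro i hi _
  match s, hn with
  | [], _ =>
    simp only [List.map_nil, List.length_append, List.length_cons, List.length_nil] at hi
    interval_cases i <;> simp [cwin, List.rotate]
  | [a], _ =>
    simp only [List.mem_singleton, forall_eq] at hs
    simp only [List.map_cons, List.map_nil, List.length_append, List.length_cons,
      List.length_nil] at hi
    interval_cases i <;> simp [cwin, List.rotate] <;> omega
  | [a, b], _ =>
    simp only [List.mem_cons, List.not_mem_nil, or_false, forall_eq_or_imp, forall_eq] at hs
    simp only [List.map_cons, List.map_nil, List.length_append, List.length_cons,
      List.length_nil] at hi
    interval_cases i <;> simp [cwin, List.rotate] <;> omega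

lemma kConvex_unbranched (s : List ℕ) (hs : ∀ x ∈ s, 1 ≤ x ∧ x ≤ 3) :
    KConvex (5 :: s ++ 5 :: s.map (fun x => 4 - x)) (max (2 * s.length - 3) s.length) := by
  rcases Nat.lt_or_ge s.length 3 with h | h
  · rw [max_eq_right (by omega)]
    exact kConvex_unbranched_of_le_two s hs (by omega)
  · rw [max_eq_left (by omega)]
    exact kConvex_unbranched_of_three_le s hs h

lemma le_of_kConvex_helicene {n k : ℕ}
    (hk : KConvex (5 :: List.replicate n 1 ++ 5 :: List.replicate n 3) k) :
    max (2 * n - 3) n ≤ k := by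
  by_contra! hlt
  have h := hk 1 (by simp) (by simp; omega)
  have hw : cwin (5 :: List.replicate n 1 ++ 5 :: List.replicate n 3) 1 (k + 1)
      = (List.replicate n 1 ++ 5 :: (List.replicate n 3 ++ [5])).take (k + 1) := by
    simp [cwin]
  rw [hw, List.take_append, List.sum_append, List.take_replicate, List.sum_replicate,
    List.length_replicate] at h
  rcases Nat.lt_or_ge k n with hkn | hkn
  · rw [Nat.min_eq_left hkn, Nat.sub_eq_zero_of_le hkn] at h
    simp at h
  · obtain ⟨j, rfl⟩ := Nat.exists_eq_add_of_le hkn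
    have hj : j < n := by omega
    rw [Nat.min_eq_right (by omega), show n + j + 1 - n = j + 1 by omega, List.take_succ_cons,
      List.take_append_of_le_length (by simp; omega), List.take_replicate,
      Nat.min_eq_left hj.le] at h
    simp at h
    omega

/-- For every `h ≥ 2` and every code of the form
`5 s₁ … s_(h-2) 5 s̄₁ … s̄_(h-2)` with each `sᵢ ∈ {1,2,3}` and `s̄ᵢ = 4 - sᵢ`,
the convexity deficit is at most `max {2h - 7, h - 2}`; moreover the helicene
code `5 1^(h-2) 5 3^(h-2)` attains this bound, so it has the maximal convexity
deficit among all such codes. -/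
theorem cd_unbranched_le (h : ℕ) (hh : 2 ≤ h) :
    (∀ s : List ℕ, s.length = h - 2 → (∀ x ∈ s, 1 ≤ x ∧ x ≤ 3) →
      cd (5 :: s ++ 5 :: s.map (fun x => 4 - x)) ≤ max (2 * h - 7) (h - 2)) ∧
    cd (5 :: List.replicate (h - 2) 1 ++ 5 :: List.replicate (h - 2) 3)
      = max (2 * h - 7) (h - 2) := by
  have hmax : max (2 * h - 7) (h - 2) = max (2 * (h - 2) - 3) (h - 2) := by omega
  have upper : ∀ s : List ℕ, s.length = h - 2 → (∀ x ∈ s, 1 ≤ x ∧ x ≤ 3) →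
      KConvex (5 :: s ++ 5 :: s.map (fun x => 4 - x)) (max (2 * h - 7) (h - 2)) := by
    intro s hl hs
    rw [hmax, ← hl]
    exact kConvex_unbranched s hs
  refine ⟨fun s hl hs => Nat.sInf_le (upper s hl hs), le_antisymm (Nat.sInf_le ?_) ?_⟩
  · simpa using upper (List.replicate (h - 2) 1) (by simp)
      (fun x hx => by simp [List.eq_of_mem_replicate hx])
  · refine le_csInf ⟨_, fun i _ hle => absurd hle (Nat.not_succ_le_self _)⟩ fun k hk => ?_
    rw [hmax]
    exact le_of_kConvex_helicene hk
end

section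
/- For every $h \ge 7$, the convexity deficit of the spiral code $w(h-2)$ is at least $2h - 8$: there exists a cyclic window of length $2h - 8$ in $w(h-2)$ whose sum is strictly less than $2(2h-8)$, namely the window obtained from $w(h-2)$ by erasing the six cyclically consecutive symbols $533323$, which has sum $4h - 17$. -/
/-- The winding of a code: the sum of its entries minus twice its length. -/
def win (c : List ℕ) : ℤ := (c.sum : ℤ) - 2 * c.length

/-- The `k`-th block `(2^k 3)^3` of the infinite code
`a = ⊕_{k=0}^∞ (2^k 3)^3 = 33323232322322322322232223…`. -/
def blockA (k : ℕ) : List ℕ := (List.replicate 3 (List.replicate k 2 ++ [3])).flatten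

/-- The `k`-th block `(2^k 1)^3` of the infinite code
`b = ⊕_{k=0}^∞ (2^k 1)^3 = 11121212122122122122212221…`. -/
def blockB (k : ℕ) : List ℕ := (List.replicate 3 (List.replicate k 2 ++ [1])).flatten

/-- `a l`: the first `l` symbols of the infinite code `a`.
(The concatenation of the first `l` blocks has length `3 * l * (l + 1) / 2 ≥ l`,
so truncating it to `l` symbols yields exactly the first `l` symbols of `a`.) -/
def aPrefix (l : ℕ) : List ℕ := (((List.range l).map blockA).flatten).take l

/-- `b l`: the first `l` symbols of the infinite code `b`. -/
def bPrefix (l : ℕ) : List ℕ := (((List.range l).map blockB).flatten).take l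

/-- The boundary-edges code `w l = 5 ⊕ a(l) ⊕ 5 ⊕ ρ(b(l))` of the spiral
benzenoid `S (l + 2)` on `l + 2` hexagons. -/
def spiralCode (l : ℕ) : List ℕ := 5 :: aPrefix l ++ 5 :: (bPrefix l).reverse

theorem blockB_eq_map_blockA (k : ℕ) : blockB k = (blockA k).map (4 - ·) := by
  simp [blockA, blockB]

theorem bPrefix_eq_map_aPrefix (l : ℕ) : bPrefix l = (aPrefix l).map (4 - ·) := by
  simp only [aPrefix, bPrefix, List.map_take, List.map_flatten, List.map_map,
    Function.comp_def, funext blockB_eq_map_blockA]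

theorem eq_two_or_three_of_mem_aPrefix {l x : ℕ} (hx : x ∈ aPrefix l) : x = 2 ∨ x = 3 := by
  have h := List.mem_of_mem_take hx
  simp only [List.mem_flatten, List.mem_map, blockA] at h
  obtain ⟨_, ⟨k, _, rfl⟩, h⟩ := h
  simp only [List.mem_flatten, List.mem_replicate] at h
  obtain ⟨_, ⟨_, rfl⟩, h⟩ := h
  simp only [List.mem_append, List.mem_replicate, List.mem_singleton] at h
  tauto

theorem le_length_flatten_blockA (l : ℕ) :
    l ≤ (((List.range l).map blockA).flatten).length := by
  induction l with
  | zero => simp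
  | succ n ih =>
    have : 1 ≤ (blockA n).length := by simp [blockA]; omega
    simp only [List.range_succ, List.map_append, List.flatten_append, List.length_append,
      List.map_cons, List.map_nil, List.flatten_cons, List.flatten_nil, List.length_nil]
    omega

theorem length_aPrefix (l : ℕ) : (aPrefix l).length = l := by
  simpa only [aPrefix, List.length_take] using min_eq_left (le_length_flatten_blockA l)

theorem exists_aPrefix_eq (n : ℕ) : ∃ t, aPrefix (n + 5) = [3, 3, 3, 2, 3] ++ t := by
  simp [aPrefix, List.range_succ_eq_map, blockA, List.replicate_succ]

theorem sum_add_sum_map_four_sub (s : List ℕ) (hs : ∀ x ∈ s, x = 2 ∨ x = 3) :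
    s.sum + (s.map (4 - ·)).sum = 4 * s.length := by
  induction s with
  | nil => simp
  | cons x s ih =>
    have := ih fun y hy => hs y (List.mem_cons_of_mem _ hy)
    have := hs x List.mem_cons_self
    simp only [List.sum_cons, List.map_cons, List.length_cons]
    omega

/-- The spiral code splits as `533323` followed by a remainder of total excess `-1`
(relative to the average value `2`), all of whose nonempty suffixes have negative excess. -/
theorem exists_spiralCode_eq (n : ℕ) :
    ∃ r, spiralCode (n + 5) = [5, 3, 3, 3, 2, 3] ++ r ∧ r.length = 2 * n + 6 ∧
      r.sum = 4 * n + 11 ∧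
      ∀ i < r.length, (r.drop i).sum < 2 * (r.drop i).length := by
  obtain ⟨t, ht⟩ := exists_aPrefix_eq n
  have hlen := length_aPrefix (n + 5)
  have hmem : ∀ x ∈ t, x = 2 ∨ x = 3 := fun x hx =>
    eq_two_or_three_of_mem_aPrefix (l := n + 5) (by simp [ht, hx])
  have hsum := sum_add_sum_map_four_sub t hmem
  have htl : t.length = n := by simpa [ht] using hlen
  obtain ⟨u, hu⟩ : ∃ u, u = ([1, 1, 2, 1] ++ t.map (4 - ·)).reverse := ⟨_, rfl⟩
  have hu2 : ∀ x ∈ u, x ≤ 2 := by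
    intro x hx
    simp only [hu, List.mem_reverse, List.mem_append, List.mem_map, List.mem_cons,
      List.not_mem_nil, or_false] at hx
    rcases hx with hx | ⟨y, hy, rfl⟩
    · omega
    · have := hmem y hy
      omega
  have hul : u.length = n + 4 := by simp [hu, htl]
  have hus : u.sum = 5 + (t.map (4 - ·)).sum := by
    rw [hu, List.sum_reverse]; simp; omega
  have hrl : (t ++ 5 :: (u ++ [1])).length = 2 * n + 6 := by
    simp [htl, hul]; omega
  have hrs : (t ++ 5 :: (u ++ [1])).sum = 4 * n + 11 := by
    simp [hus]; omega
  refine ⟨t ++ 5 :: (u ++ [1]), ?_, hrl, hrs, fun i hi => ?_⟩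
  · simp [spiralCode, bPrefix_eq_map_aPrefix, ht, hu]
  · rcases le_or_gt i t.length with h | h
    · have h1 := List.sum_take_add_sum_drop (t ++ 5 :: (u ++ [1])) i
      rw [List.take_append_of_le_length h] at h1
      have h2 := List.card_nsmul_le_sum (t.take i) 2 fun x hx => by
        have := hmem x (List.mem_of_mem_take hx)
        omega
      rw [List.length_take, min_eq_left h, smul_eq_mul] at h2
      rw [List.length_drop]
      omega
    · obtain ⟨j, rfl⟩ := Nat.exists_eq_add_of_lt h
      have hj : j ≤ u.length := by omega
      have h1 : (t ++ 5 :: (u ++ [1])).drop (t.length + j + 1) = u.drop j ++ [1] := by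
        rw [add_assoc, List.drop_append, List.drop_eq_nil_of_le (by omega)]
        simp [List.drop_append_of_le_length hj]
      have h2 := List.sum_le_card_nsmul (u.drop j) 2 fun x hx => hu2 x (List.mem_of_mem_drop hx)
      rw [smul_eq_mul] at h2
      rw [h1, List.sum_append, List.length_append, List.sum_singleton, List.length_singleton]
      omega

theorem cwin_eq_drop {c : List ℕ} {i m : ℕ} (h : i + m = c.length) : cwin c i m = c.drop i := by
  rw [cwin, List.rotate_eq_drop_append_take (by omega), List.take_left' (by simp; omega)]

theorem le_cd {c : List ℕ} {m : ℕ} (h : ∀ k < m, ¬ KConvex c k) : m ≤ cd c :=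
  le_csInf ⟨c.length, fun _ _ h => by omega⟩ fun k hk => not_lt.mp fun hlt => h k hlt hk

/-- For every `h ≥ 7`, the convexity deficit of the spiral code `w (h - 2)` is
at least `2h - 8`: the cyclic window of length `2h - 8` obtained from
`w (h - 2)` by erasing its six cyclically consecutive initial symbols
`5 3 3 3 2 3` has sum `4h - 17`, which is strictly less than `2 * (2h - 8)`. -/
theorem spiralCode_cd_lower_bound (h : ℕ) (hh : 7 ≤ h) :
    cwin (spiralCode (h - 2)) 0 6 = [5, 3, 3, 3, 2, 3] ∧
    (cwin (spiralCode (h - 2)) 6 (2 * h - 8)).sum = 4 * h - 17 ∧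
    (cwin (spiralCode (h - 2)) 6 (2 * h - 8)).sum < 2 * (2 * h - 8) ∧
    2 * h - 8 ≤ cd (spiralCode (h - 2)) := by
  obtain ⟨n, rfl⟩ := Nat.exists_eq_add_of_le' hh
  obtain ⟨r, hr, hl, hs, hd⟩ := exists_spiralCode_eq n
  have hlen : (spiralCode (n + 5)).length = 2 * n + 12 := by
    simp [hr, hl]
  have hdrop (i : ℕ) : (spiralCode (n + 5)).drop (6 + i) = r.drop i := by
    rw [hr, ← List.drop_drop]; rfl
  rw [show n + 7 - 2 = n + 5 by omega, cwin_eq_drop (i := 6) (by omega)]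
  have h0 : (spiralCode (n + 5)).drop 6 = r := hdrop 0
  rw [h0]
  refine ⟨by simp [cwin, hr], by omega, by omega, le_cd fun k hk hconv => ?_⟩
  have h1 := hd (r.length - (k + 1)) (by omega)
  have h2 := hconv (6 + (r.length - (k + 1))) (by omega) (by omega)
  rw [cwin_eq_drop (by omega), hdrop] at h2
  rw [List.length_drop] at h1
  omega
end
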